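/- For n ≥ 3 define a_n = inf over all U ∈ ℂ^{n×2} with orthonormal columns of (max over i ≠ j of the smallest eigenvalue of Γ_{ij} = U_{ij}U_{ij}^H), and b_n = 1/√(a_n). Then the sequence (b_n)_{n≥3} is nondecreasing, and lim_{n→∞} √(n/α)/b_n = 1 where α = 2 − 2/√3; equivalently, n·a_n → α as n → ∞. -/

import Mathlib

open Matrix

/-- The smaller eigenvalue of the Gram matrix `Γ_{ij} = U_{ij} U_{ij}ᴴ` of rows `i`, `j`. -/
noncomputable def minEig {n : ℕ} (U : Matrix (Fin n) (Fin 2) ℂ) (i j : Fin n) : ℝ :=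
  min ((Matrix.isHermitian_mul_conjTranspose_self (U.submatrix ![i, j] id)).eigenvalues 0)
      ((Matrix.isHermitian_mul_conjTranspose_self (U.submatrix ![i, j] id)).eigenvalues 1)

/-- `a n` is the infimum, over `U ∈ ℂ^{n×2}` with orthonormal columns, of the maximum over
`i ≠ j` of the smallest eigenvalue of `Γ_{ij} = U_{ij} U_{ij}ᴴ`. -/
noncomputable def aSeq (n : ℕ) : ℝ :=
  sInf {x : ℝ | ∃ U : Matrix (Fin n) (Fin 2) ℂ, Uᴴ * U = 1 ∧
    x = sSup {y : ℝ | ∃ i j : Fin n, i ≠ j ∧ y = minEig U i j}}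

/-- `b n = 1 / √(a n)`. -/
noncomputable def bSeq (n : ℕ) : ℝ := 1 / Real.sqrt (aSeq n)

theorem weighted_norm_le_of_card_le_four {E ι : Type*} [NormedAddCommGroup E]
    [InnerProductSpace ℝ E] (w : ι → E) (S : Finset ι) (hcard : S.card ≤ 4) (c : ι → ℝ)
    (hc : ∀ i ∈ S, 0 ≤ c i) (hr : ∀ i ∈ S, 1 / 2 ≤ ‖w i‖) (hsum : ∑ i ∈ S, c i • w i = 0)
    (hpair : ∀ i ∈ S, ∀ j ∈ S, i ≠ j →
      ‖w i‖ * ‖w j‖ - (‖w i‖ + ‖w j‖) + 1 / 2 ≤ inner ℝ (w i) (w j)) :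
    ∑ i ∈ S, c i * ‖w i‖ ≤ (3 + √3) / 4 * ∑ i ∈ S, c i := by
  classical
  set C := ∑ i ∈ S, c i with hC
  set L := ∑ i ∈ S, c i * ‖w i‖ with hL
  have hC0 : 0 ≤ C := Finset.sum_nonneg hc
  rcases hC0.eq_or_lt with h0 | hCpos
  · have hz := (Finset.sum_eq_zero_iff_of_nonneg hc).1 (h0.symm ▸ hC.symm)
    have : L = 0 := Finset.sum_eq_zero fun i hi => by rw [hz i hi, zero_mul]
    rw [this, ← h0]; simp
  have key : ∀ i ∈ S, (L - C) * (‖w i‖ - 1) + c i * (2 * ‖w i‖ - 1 / 2) ≤ C / 2 := by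
    intro i hi
    have h1 : ∑ j ∈ S, c j * inner ℝ (w i) (w j) = 0 := by
      have := congrArg (fun x => inner ℝ (w i) x) hsum
      simpa [inner_sum, inner_smul_right] using this
    have h2 : ∑ j ∈ S, c j * ((‖w i‖ * ‖w j‖ - (‖w i‖ + ‖w j‖) + 1 / 2) +
        if i = j then 2 * ‖w i‖ - 1 / 2 else 0) ≤ ∑ j ∈ S, c j * inner ℝ (w i) (w j) := by
      refine Finset.sum_le_sum fun j hj => mul_le_mul_of_nonneg_left ?_ (hc j hj)
      split_ifs with h
      · subst h
        rw [real_inner_self_eq_norm_sq]; nlinarith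
      · simpa using hpair i hi j hj h
    have h3 : ∑ j ∈ S, c j * ((‖w i‖ * ‖w j‖ - (‖w i‖ + ‖w j‖) + 1 / 2) +
        if i = j then 2 * ‖w i‖ - 1 / 2 else 0) =
        ‖w i‖ * L - ‖w i‖ * C - L + C / 2 + c i * (2 * ‖w i‖ - 1 / 2) := by
      have : ∀ j ∈ S, c j * ((‖w i‖ * ‖w j‖ - (‖w i‖ + ‖w j‖) + 1 / 2) +
          if i = j then 2 * ‖w i‖ - 1 / 2 else 0) =
          (‖w i‖ - 1) * (c j * ‖w j‖) + (1 / 2 - ‖w i‖) * c j +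
            if i = j then c j * (2 * ‖w i‖ - 1 / 2) else 0 := by
        intro j _
        split_ifs <;> ring
      rw [Finset.sum_congr rfl this, Finset.sum_add_distrib, Finset.sum_add_distrib,
        ← Finset.mul_sum, ← Finset.mul_sum, Finset.sum_ite_eq, if_pos hi, ← hC, ← hL]
      ring
    linarith
  set m : ℝ := (S.card : ℝ) with hm
  have hm4 : m ≤ 4 := by rw [hm]; exact_mod_cast hcard
  set T := ∑ i ∈ S, (2 * ‖w i‖ - 1 / 2) with hT
  have hT' : ∑ i ∈ S, (‖w i‖ - 1) = T / 2 - 3 / 4 * m := by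
    have : ∀ i ∈ S, ‖w i‖ - 1 = (1 / 2) * (2 * ‖w i‖ - 1 / 2) - 3 / 4 := by intro i _; ring
    rw [Finset.sum_congr rfl this, Finset.sum_sub_distrib, ← Finset.mul_sum, Finset.sum_const,
      nsmul_eq_mul]
    ring
  have hlin : ∑ i ∈ S, c i * (2 * ‖w i‖ - 1 / 2) = 2 * L - C / 2 := by
    have : ∀ i ∈ S, c i * (2 * ‖w i‖ - 1 / 2) = 2 * (c i * ‖w i‖) - 1 / 2 * c i := by
      intro i _; ring
    rw [Finset.sum_congr rfl this, Finset.sum_sub_distrib, ← Finset.mul_sum, ← Finset.mul_sum]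
    ring
  have hB : (L - C) * (T / 2 - 3 / 4 * m) + (2 * L - C / 2) ≤ m * (C / 2) := by
    rw [← hT', ← hlin, Finset.mul_sum, ← Finset.sum_add_distrib, hm, ← nsmul_eq_mul]
    exact Finset.sum_le_card_nsmul _ _ _ key
  have hA : (L - C) * (L - C) + (C / 2 * (2 * L - C / 2) - C ^ 2 / 16 * T) ≤ C * (C / 2) := by
    have h1 : ∑ i ∈ S, c i * ((L - C) * (‖w i‖ - 1) + c i * (2 * ‖w i‖ - 1 / 2)) ≤
        ∑ i ∈ S, c i * (C / 2) :=
      Finset.sum_le_sum fun i hi => mul_le_mul_of_nonneg_left (key i hi) (hc i hi)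
    have h2 : ∑ i ∈ S, ((L - C) * (c i * ‖w i‖) - (L - C) * c i +
        (C / 2 * (c i * (2 * ‖w i‖ - 1 / 2)) - C ^ 2 / 16 * (2 * ‖w i‖ - 1 / 2))) ≤
        ∑ i ∈ S, c i * ((L - C) * (‖w i‖ - 1) + c i * (2 * ‖w i‖ - 1 / 2)) := by
      refine Finset.sum_le_sum fun i hi => ?_
      have := mul_nonneg (sq_nonneg (c i - C / 4)) (by linarith [hr i hi] : 0 ≤ 2 * ‖w i‖ - 1 / 2)
      nlinarith
    rw [Finset.sum_add_distrib, Finset.sum_sub_distrib, Finset.sum_sub_distrib, ← Finset.mul_sum,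
      ← Finset.mul_sum, ← Finset.mul_sum, ← Finset.mul_sum, hlin, ← hC, ← hL, ← hT] at h2
    rw [← Finset.sum_mul, ← hC] at h1
    linarith
  by_contra! hcon
  have hs3 : √3 ^ 2 = 3 := Real.sq_sqrt (by norm_num)
  have hs1 : 1 < √3 := by rw [Real.lt_sqrt] <;> norm_num
  obtain ⟨ρ, hρ⟩ : ∃ ρ, L = C * (1 + ρ) := ⟨L / C - 1, by field_simp; ring⟩
  have hρ1 : (√3 - 1) / 4 < ρ := by
    rw [hρ] at hcon
    have : C * ((3 + √3) / 4) < C * (1 + ρ) := by linarith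
    linarith [lt_of_mul_lt_mul_left this hC0]
  have hρ0 : 0 < ρ := by linarith
  have hB' : ρ * (T / 2 - 3) + (2 * ρ + 3 / 2) ≤ 2 := by
    have h1 : C * (ρ * (T / 2 - 3 / 4 * m) + (2 * ρ + 3 / 2)) ≤ C * (m / 2) := by
      rw [hρ] at hB; linarith
    have := le_of_mul_le_mul_left h1 hCpos
    nlinarith
  have hA' : ρ ^ 2 + ρ + 1 / 4 ≤ T / 16 := by
    have h1 : C ^ 2 * (ρ ^ 2 + ρ + 1 / 4) ≤ C ^ 2 * (T / 16) := by
      rw [hρ] at hA; linarith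
    exact le_of_mul_le_mul_left h1 (by positivity)
  have hfin : 8 * ρ ^ 3 + 8 * ρ ^ 2 + ρ - 1 / 2 ≤ 0 := by nlinarith
  have h4 : 1 / 8 < ρ ^ 2 + ρ / 2 := by nlinarith
  nlinarith

theorem weighted_norm_le {E ι : Type*} [NormedAddCommGroup E]
    [InnerProductSpace ℝ E] [FiniteDimensional ℝ E] (hE : Module.finrank ℝ E = 3)
    (w : ι → E) (S : Finset ι) (c : ι → ℝ)
    (hc : ∀ i ∈ S, 0 ≤ c i) (hr : ∀ i ∈ S, 1 / 2 ≤ ‖w i‖) (hsum : ∑ i ∈ S, c i • w i = 0)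
    (hpair : ∀ i ∈ S, ∀ j ∈ S, i ≠ j →
      ‖w i‖ * ‖w j‖ - (‖w i‖ + ‖w j‖) + 1 / 2 ≤ inner ℝ (w i) (w j)) :
    ∑ i ∈ S, c i * ‖w i‖ ≤ (3 + √3) / 4 * ∑ i ∈ S, c i := by
  classical
  induction S using Finset.strongInduction generalizing c with
  | H S ih =>
  by_cases hcard : S.card ≤ 4
  · exact weighted_norm_le_of_card_le_four w S hcard c hc hr hsum hpair
  obtain ⟨d, hd1, hd2, hd3, hd4⟩ : ∃ d : ι → ℝ, ∑ i ∈ S, d i • w i = 0 ∧ ∑ i ∈ S, d i = 0 ∧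
      (∃ i ∈ S, d i < 0) ∧ 0 ≤ ∑ i ∈ S, d i * ‖w i‖ := by
    have hnot : ¬ LinearIndependent ℝ (fun i : S => ((w i, 1) : E × ℝ)) := by
      intro h
      have := h.fintype_card_le_finrank
      rw [Module.finrank_prod, hE, Fintype.card_coe] at this
      simp at this
      omega
    obtain ⟨g, hg, i, hi⟩ := Fintype.not_linearIndependent_iff.1 hnot
    have hg1 : ∑ i, g i • w i = 0 := by simpa [Prod.fst_sum] using congrArg Prod.fst hg
    have hg2 : ∑ i, g i = 0 := by simpa [Prod.snd_sum] using congrArg Prod.snd hg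
    have hneg : ∀ g : S → ℝ, ∑ i, g i = 0 → g i ≠ 0 → ∃ i, g i < 0 := by
      intro g hg hi
      by_contra! h
      exact hi ((Finset.sum_eq_zero_iff_of_nonneg fun i _ => h i).1 hg i (Finset.mem_univ _))
    obtain ⟨g, hg1, hg2, hi, h4⟩ : ∃ g : S → ℝ, ∑ i, g i • w i = 0 ∧ ∑ i, g i = 0 ∧ g i ≠ 0 ∧
        0 ≤ ∑ i, g i * ‖w i‖ := by
      rcases le_total 0 (∑ i, g i * ‖w i‖) with h | h
      · exact ⟨g, hg1, hg2, hi, h⟩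
      · exact ⟨-g, by simpa using hg1, by simpa using hg2, by simpa using hi, by simpa using h⟩
    obtain ⟨k, hk⟩ := hneg g hg2 hi
    refine ⟨fun i => if h : i ∈ S then g ⟨i, h⟩ else 0, ?_, ?_, ⟨k, k.2, by simpa using hk⟩, ?_⟩
    · rw [← Finset.sum_coe_sort]; simpa using hg1
    · rw [← Finset.sum_coe_sort]; simpa using hg2
    · rw [← Finset.sum_coe_sort]; simpa using h4
  obtain ⟨k, hk, hmin⟩ := Finset.exists_min_image (S.filter fun i => d i < 0)
    (fun i => c i / -d i) (by obtain ⟨i, hi, h⟩ := hd3; exact ⟨i, by simp [hi, h]⟩)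
  obtain ⟨hkS, hdk⟩ := Finset.mem_filter.1 hk
  set τ := c k / -d k with hτ
  have hτ0 : 0 ≤ τ := div_nonneg (hc k hkS) (by linarith)
  have hck : c k + τ * d k = 0 := by rw [hτ]; have := hdk.ne; field_simp; ring
  have hc' : ∀ i ∈ S, 0 ≤ c i + τ * d i := by
    intro i hi
    rcases lt_or_ge (d i) 0 with h | h
    · have := hmin i (by simp [hi, h])
      rw [le_div_iff₀ (by linarith)] at this
      linarith
    · have := hc i hi
      positivity
  have e1 : ∑ i ∈ S.erase k, (c i + τ * d i) • w i = 0 := by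
    rw [Finset.sum_erase S (by simp [hck])]
    simp only [add_smul, mul_smul, Finset.sum_add_distrib, ← Finset.smul_sum, hsum, hd1]
    simp
  have e2 := ih (S.erase k) (Finset.erase_ssubset hkS) (fun i => c i + τ * d i)
    (fun i hi => hc' i (Finset.mem_of_mem_erase hi)) (fun i hi => hr i (Finset.mem_of_mem_erase hi))
    e1 (fun i hi j hj => hpair i (Finset.mem_of_mem_erase hi) j (Finset.mem_of_mem_erase hj))
  rw [Finset.sum_erase S (by simp [hck]), Finset.sum_erase S (by simp [hck])] at e2
  simp only [add_mul, mul_assoc, Finset.sum_add_distrib, ← Finset.mul_sum, hd2] at e2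
  have := mul_nonneg hτ0 hd4
  linarith

/-- A closed polygon in a three-dimensional space with `n` edges has perimeter at most
`(3 + √3) / 4 * n` when `‖v i‖ + ‖v j‖ - ‖v i + v j‖ ≤ 1` for `i ≠ j`. -/
theorem sum_norm_le {E ι : Type*} [NormedAddCommGroup E] [InnerProductSpace ℝ E]
    [FiniteDimensional ℝ E] (hE : Module.finrank ℝ E = 3) [Fintype ι] (v : ι → E)
    (hsum : ∑ i, v i = 0) (hpair : ∀ i j, i ≠ j → 1 ≤ ‖v i‖ + ‖v j‖ →
      ‖v i‖ * ‖v j‖ - (‖v i‖ + ‖v j‖) + 1 / 2 ≤ inner ℝ (v i) (v j)) :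
    ∑ i, ‖v i‖ ≤ (3 + √3) / 4 * Fintype.card ι := by
  classical
  set S := Finset.univ.filter fun i => v i ≠ 0 with hS
  set w : ι → E := fun i => if ‖v i‖ < 1 / 2 then (2 * ‖v i‖)⁻¹ • v i else v i with hw
  set c : ι → ℝ := fun i => if ‖v i‖ < 1 / 2 then 2 * ‖v i‖ else 1 with hcdef
  have hc0 : ∀ i, 0 ≤ c i := by
    intro i; simp only [hcdef]; split_ifs <;> positivity
  have hc1 : ∀ i, c i ≤ 1 := by
    intro i; simp only [hcdef]; split_ifs <;> linarith
  have hcw : ∀ i, c i • w i = v i := by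
    intro i
    by_cases h0 : v i = 0
    · simp [hw, h0]
    · have : ‖v i‖ ≠ 0 := norm_ne_zero_iff.2 h0
      simp only [hcdef, hw]
      split_ifs
      · rw [smul_smul, mul_inv_cancel₀ (by simpa using this), one_smul]
      · rw [one_smul]
  have hcn : ∀ i, c i * ‖w i‖ = ‖v i‖ := by
    intro i
    rw [← hcw i, norm_smul, Real.norm_of_nonneg (hc0 i)]
  have hwS : ∀ i ∈ S, ‖v i‖ < 1 / 2 → ‖w i‖ = 1 / 2 := by
    intro i hi h
    have h0 : ‖v i‖ ≠ 0 := norm_ne_zero_iff.2 (Finset.mem_filter.1 hi).2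
    simp only [hw, if_pos h, norm_smul, norm_inv, norm_mul, norm_norm, Real.norm_ofNat]
    field_simp
  have hwS' : ∀ i, 1 / 2 ≤ ‖v i‖ → w i = v i := fun i h => by
    simp only [hw, if_neg h.not_gt]
  have hr : ∀ i ∈ S, 1 / 2 ≤ ‖w i‖ := by
    intro i hi
    rcases lt_or_ge ‖v i‖ (1 / 2) with h | h
    · exact (hwS i hi h).ge
    · rwa [hwS' i h]
  have h1 := weighted_norm_le hE w S c (fun i _ => hc0 i) hr (by
      simp only [hcw]
      rw [← hsum]
      exact Finset.sum_subset (Finset.subset_univ _) fun i _ hi => by simpa [hS] using hi) (by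
      intro i hi j hj hij
      have hcs := (abs_le.1 (abs_real_inner_le_norm (w i) (w j))).1
      rcases lt_or_ge ‖v i‖ (1 / 2) with h | h
      · rw [hwS i hi h] at hcs ⊢
        linarith
      rcases lt_or_ge ‖v j‖ (1 / 2) with h' | h'
      · rw [hwS j hj h'] at hcs ⊢
        linarith
      rw [hwS' i h, hwS' j h']
      exact hpair i j hij (by linarith))
  simp only [hcn] at h1
  have h2 : ∑ i ∈ S, ‖v i‖ = ∑ i, ‖v i‖ :=
    Finset.sum_subset (Finset.subset_univ _) fun i _ hi => by simpa [hS] using hi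
  rw [← h2]
  refine h1.trans (mul_le_mul_of_nonneg_left ?_ (by positivity))
  calc ∑ i ∈ S, c i ≤ ∑ i, c i :=
        Finset.sum_le_sum_of_subset_of_nonneg (Finset.subset_univ _) fun i _ _ => hc0 i
    _ ≤ ∑ _i : ι, 1 := Finset.sum_le_sum fun i _ => hc1 i
    _ = Fintype.card ι := by simp

theorem minEig_spec {n : ℕ} (U : Matrix (Fin n) (Fin 2) ℂ) (i j : Fin n) :
    ∃ M, minEig U i j ≤ M ∧
      minEig U i j + M = (Complex.normSq (U i 0) + Complex.normSq (U i 1)) +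
        (Complex.normSq (U j 0) + Complex.normSq (U j 1)) ∧
      minEig U i j * M = Complex.normSq (U i 0 * U j 1 - U i 1 * U j 0) := by
  have h := Matrix.isHermitian_mul_conjTranspose_self (U.submatrix ![i, j] id)
  have hmul : ∀ (A : Matrix (Fin 2) (Fin 2) ℂ) a b,
      (A * Aᴴ) a b = A a 0 * star (A b 0) + A a 1 * star (A b 1) := fun A a b => by
    simp [Matrix.mul_apply, Fin.sum_univ_two]
  refine ⟨max (h.eigenvalues 0) (h.eigenvalues 1), min_le_max, ?_, ?_⟩
  · have := h.trace_eq_sum_eigenvalues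
    rw [Fin.sum_univ_two] at this
    simp only [minEig, min_add_max]
    apply Complex.ofReal_injective
    refine Eq.trans (by simp) (this.symm.trans ?_)
    rw [Matrix.trace_fin_two, hmul, hmul]
    simp [Complex.normSq_eq_conj_mul_self, mul_comm]
  · have := h.det_eq_prod_eigenvalues
    rw [Fin.prod_univ_two] at this
    simp only [minEig, min_mul_max]
    apply Complex.ofReal_injective
    refine Eq.trans (by simp) (this.symm.trans ?_)
    rw [Matrix.det_fin_two, hmul, hmul, hmul, hmul]
    simp [Complex.normSq_eq_conj_mul_self]
    ring

theorem minEig_nonneg {n : ℕ} (U : Matrix (Fin n) (Fin 2) ℂ) (i j : Fin n) :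
    0 ≤ minEig U i j := by
  obtain ⟨M, h1, h2, h3⟩ := minEig_spec U i j
  have := Complex.normSq_nonneg (U i 0)
  have := Complex.normSq_nonneg (U i 1)
  have := Complex.normSq_nonneg (U j 0)
  have := Complex.normSq_nonneg (U j 1)
  have := Complex.normSq_nonneg (U i 0 * U j 1 - U i 1 * U j 0)
  by_contra! h
  nlinarith

theorem bddAbove_minEig {n : ℕ} (U : Matrix (Fin n) (Fin 2) ℂ) :
    BddAbove {y : ℝ | ∃ i j : Fin n, i ≠ j ∧ y = minEig U i j} := by
  refine ((Set.finite_range fun p : Fin n × Fin n => minEig U p.1 p.2).subset ?_).bddAbove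
  rintro _ ⟨i, j, -, rfl⟩
  exact ⟨(i, j), rfl⟩

theorem sSup_minEig_nonneg {n : ℕ} (U : Matrix (Fin n) (Fin 2) ℂ) :
    0 ≤ sSup {y : ℝ | ∃ i j : Fin n, i ≠ j ∧ y = minEig U i j} := by
  apply Real.sSup_nonneg
  rintro _ ⟨i, j, -, rfl⟩
  exact minEig_nonneg U i j

theorem aSeq_le {n : ℕ} (U : Matrix (Fin n) (Fin 2) ℂ) (hU : Uᴴ * U = 1) :
    aSeq n ≤ sSup {y : ℝ | ∃ i j : Fin n, i ≠ j ∧ y = minEig U i j} := by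
  refine csInf_le ⟨0, ?_⟩ ⟨U, hU, rfl⟩
  rintro _ ⟨V, -, rfl⟩
  exact sSup_minEig_nonneg V

theorem exists_orthonormal_columns {n : ℕ} (hn : 2 ≤ n) :
    ∃ U : Matrix (Fin n) (Fin 2) ℂ, Uᴴ * U = 1 := by
  refine ⟨(1 : Matrix (Fin n) (Fin n) ℂ).submatrix id (Fin.castLE hn), ?_⟩
  rw [conjTranspose_submatrix, ← submatrix_mul _ _ _ _ _ Function.bijective_id]
  simp [submatrix_one _ (Fin.castLE_injective hn)]

theorem orthonormal_columns_iff {ι : Type*} [Fintype ι] (U : Matrix ι (Fin 2) ℂ) :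
    Uᴴ * U = 1 ↔ ∑ i, Complex.normSq (U i 0) = 1 ∧ ∑ i, Complex.normSq (U i 1) = 1 ∧
      ∑ i, U i 0 * star (U i 1) = 0 := by
  have key : ∀ k, (Uᴴ * U) k k = ((∑ i, Complex.normSq (U i k) : ℝ) : ℂ) := by
    intro k
    simp [Matrix.mul_apply, Complex.normSq_eq_conj_mul_self]
  have h10 : (Uᴴ * U) 1 0 = ∑ i, U i 0 * star (U i 1) := by
    simp [Matrix.mul_apply, mul_comm]
  have h01 : (Uᴴ * U) 0 1 = star (∑ i, U i 0 * star (U i 1)) := by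
    simp [Matrix.mul_apply, mul_comm]
  constructor
  · intro h
    refine ⟨?_, ?_, ?_⟩
    · have := key 0
      rw [h, Matrix.one_apply_eq] at this
      exact_mod_cast this.symm
    · have := key 1
      rw [h, Matrix.one_apply_eq] at this
      exact_mod_cast this.symm
    · rw [← h10, h]; simp
  · rintro ⟨h0, h1, h2⟩
    ext a b
    fin_cases a <;> fin_cases b
    · exact (key 0).trans (by simp [h0])
    · exact h01.trans (by rw [h2]; simp)
    · exact h10.trans (by rw [h2]; simp)
    · exact (key 1).trans (by simp [h1])

theorem aSeq_succ_le {n : ℕ} (hn : 2 ≤ n) : aSeq (n + 1) ≤ aSeq n := by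
  obtain ⟨U₀, hU₀⟩ := exists_orthonormal_columns hn
  refine le_csInf ⟨_, U₀, hU₀, rfl⟩ ?_
  rintro _ ⟨U, hU, rfl⟩
  set V : Matrix (Fin (n + 1)) (Fin 2) ℂ := Matrix.of (Fin.cons (fun _ => 0) U) with hV
  have hV0 : ∀ k, V 0 k = 0 := fun k => rfl
  have hVs : ∀ i k, V (Fin.succ i) k = U i k := fun i k => rfl
  have hV1 : Vᴴ * V = 1 := by
    rw [orthonormal_columns_iff] at hU ⊢
    simpa [Fin.sum_univ_succ, hV0, hVs] using hU
  refine (aSeq_le V hV1).trans (Real.sSup_le ?_ (sSup_minEig_nonneg U))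
  rintro _ ⟨i, j, hij, rfl⟩
  have hzero : ∀ i j, i = 0 ∨ j = 0 → minEig V i j ≤ 0 := by
    intro i j h
    obtain ⟨M, h1, -, h3⟩ := minEig_spec V i j
    have : minEig V i j * M = 0 := by rcases h with rfl | rfl <;> simp [h3, hV0]
    by_contra! h
    have := mul_pos h (h.trans_le h1)
    linarith
  induction i using Fin.cases with
  | zero => exact (hzero _ _ (.inl rfl)).trans (sSup_minEig_nonneg U)
  | succ i =>
    induction j using Fin.cases with
    | zero => exact (hzero _ _ (.inr rfl)).trans (sSup_minEig_nonneg U)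
    | succ j =>
      refine le_csSup (bddAbove_minEig U) ⟨i, j, fun h => hij (by rw [h]), ?_⟩
      have : V.submatrix ![i.succ, j.succ] id = U.submatrix ![i, j] id := by
        ext a b
        fin_cases a <;> rfl
      simp only [minEig, this]

/-- The Bloch vector of `(p, q) ∈ ℂ²`. -/
noncomputable def blochVector (p q : ℂ) : EuclideanSpace ℝ (Fin 3) :=
  !₂[Complex.normSq p - Complex.normSq q, 2 * (p * star q).re, 2 * (p * star q).im]

theorem inner_blochVector (p q p' q' : ℂ) :
    inner ℝ (blochVector p q) (blochVector p' q') =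
      (Complex.normSq p + Complex.normSq q) * (Complex.normSq p' + Complex.normSq q') -
        2 * Complex.normSq (p * q' - q * p') := by
  simp [blochVector, PiLp.inner_apply, Fin.sum_univ_three, Complex.normSq_apply]
  ring

theorem norm_blochVector (p q : ℂ) :
    ‖blochVector p q‖ = Complex.normSq p + Complex.normSq q := by
  have h : 0 ≤ Complex.normSq p + Complex.normSq q :=
    add_nonneg (Complex.normSq_nonneg _) (Complex.normSq_nonneg _)
  rw [← sq_eq_sq₀ (norm_nonneg _) h, ← real_inner_self_eq_norm_sq, inner_blochVector,
    mul_comm q p]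
  simp [sq]

theorem le_mul_sSup_minEig {n : ℕ} (U : Matrix (Fin n) (Fin 2) ℂ) (hU : Uᴴ * U = 1) :
    2 - 2 / √3 ≤ n * sSup {y : ℝ | ∃ i j : Fin n, i ≠ j ∧ y = minEig U i j} := by
  set s := sSup {y : ℝ | ∃ i j : Fin n, i ≠ j ∧ y = minEig U i j} with hs
  have hs0 : 0 ≤ s := sSup_minEig_nonneg U
  obtain ⟨hU0, hU1, hU2⟩ := (orthonormal_columns_iff U).1 hU
  have hs3 : √3 ^ 2 = 3 := Real.sq_sqrt (by norm_num)
  have hs1 : 0 < √3 := by positivity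
  have hα : (3 + √3) * (2 - 2 / √3) = 4 := by field_simp; nlinarith
  have key : ∀ t : ℝ, s < t → 2 - 2 / √3 ≤ n * t := by
    intro t hst
    have ht : 0 < t := by linarith
    set v : Fin n → EuclideanSpace ℝ (Fin 3) :=
      fun i => (2 * t)⁻¹ • blochVector (U i 0) (U i 1) with hv
    have hsum : ∑ i, blochVector (U i 0) (U i 1) = 0 := by
      have hre := congrArg Complex.re hU2
      have him := congrArg Complex.im hU2
      simp only [Complex.re_sum, Complex.im_sum, Complex.zero_re, Complex.zero_im] at hre him
      ext k
      fin_cases k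
      · simp [blochVector, hU0, hU1]
      · simpa [blochVector, ← Finset.mul_sum] using hre
      · simpa [blochVector, ← Finset.mul_sum] using him
    have hnv : ∀ i, ‖v i‖ = (2 * t)⁻¹ * (Complex.normSq (U i 0) + Complex.normSq (U i 1)) := by
      intro i
      rw [hv, norm_smul, norm_blochVector, Real.norm_of_nonneg (by positivity)]
    have h := sum_norm_le (by simp) v (by rw [hv, ← Finset.smul_sum, hsum, smul_zero]) (by
      intro i j hij hle
      obtain ⟨M, h1, h2, h3⟩ := minEig_spec U i j
      have hm : minEig U i j ≤ t := (le_csSup (bddAbove_minEig U) ⟨i, j, hij, rfl⟩).trans hst.le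
      rw [hnv, hnv] at hle ⊢
      simp only [hv, inner_smul_left, inner_smul_right, inner_blochVector, ← h3]
      set r := Complex.normSq (U i 0) + Complex.normSq (U i 1)
      set r' := Complex.normSq (U j 0) + Complex.normSq (U j 1)
      have hle' : 2 * t ≤ r + r' := by
        rw [← mul_add, inv_mul_eq_div, le_div_iff₀ (by positivity)] at hle
        linarith
      have hM : t ≤ M := by linarith
      have h4 := mul_nonneg (sub_nonneg.2 hm) (sub_nonneg.2 hM)
      have h5 : minEig U i j * M ≤ t * (r + r') - t ^ 2 := by rw [← h2]; nlinarith
      simp only [map_inv₀, conj_trivial]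
      field_simp
      nlinarith)
    simp only [hnv, ← Finset.mul_sum, Finset.sum_add_distrib, hU0, hU1, Fintype.card_fin] at h
    rw [inv_mul_eq_div, div_le_iff₀ (by positivity)] at h
    have h6 : (3 + √3) * (2 - 2 / √3) ≤ (3 + √3) * (n * t) := by rw [hα]; linarith
    exact le_of_mul_le_mul_left h6 (by positivity)
  refine ge_of_tendsto (x := nhdsWithin s (Set.Ioi s)) (f := fun t : ℝ => n * t) ?_
    (Filter.eventually_of_mem self_mem_nhdsWithin key)
  exact (continuous_const.mul continuous_id).continuousWithinAt

theorem le_mul_aSeq {n : ℕ} (hn : 2 ≤ n) : 2 - 2 / √3 ≤ n * aSeq n := by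
  have hn0 : (0 : ℝ) < n := by exact_mod_cast (by omega : 0 < n)
  rw [← div_le_iff₀' hn0]
  obtain ⟨U₀, hU₀⟩ := exists_orthonormal_columns hn
  refine le_csInf ⟨_, U₀, hU₀, rfl⟩ ?_
  rintro _ ⟨U, hU, rfl⟩
  rw [div_le_iff₀' hn0]
  exact le_mul_sSup_minEig U hU

/-- The rows are four unit vectors of `ℂ²` whose Bloch vectors form a regular tetrahedron. -/
noncomputable def tetrahedron : Matrix (Fin 4) (Fin 2) ℂ :=
  !![1, 0; ⟨√3 / 3, 0⟩, ⟨√2 * √3 / 3, 0⟩; ⟨√3 / 3, 0⟩, ⟨-(√2 * √3) / 6, √2 / 2⟩;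
    ⟨√3 / 3, 0⟩, ⟨-(√2 * √3) / 6, -√2 / 2⟩]

theorem tetrahedron_row (a : Fin 4) :
    Complex.normSq (tetrahedron a 0) + Complex.normSq (tetrahedron a 1) = 1 := by
  have h2 : √2 ^ 2 = 2 := Real.sq_sqrt (by norm_num)
  have h3 : √3 ^ 2 = 3 := Real.sq_sqrt (by norm_num)
  fin_cases a <;> simp [tetrahedron, Complex.normSq_apply] <;> ring_nf <;> norm_num [h2, h3]

theorem tetrahedron_det (a b : Fin 4) :
    Complex.normSq (tetrahedron a 0 * tetrahedron b 1 - tetrahedron a 1 * tetrahedron b 0) ≤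
      2 / 3 := by
  have h2 : √2 ^ 2 = 2 := Real.sq_sqrt (by norm_num)
  have h3 : √3 ^ 2 = 3 := Real.sq_sqrt (by norm_num)
  have h4 : √3 ^ 4 = 9 := by rw [show √3 ^ 4 = (√3 ^ 2) ^ 2 by ring, h3]; norm_num
  fin_cases a <;> fin_cases b <;> simp [tetrahedron, Complex.normSq_apply] <;> ring_nf <;>
    norm_num [h2, h3, h4]

theorem tetrahedron_columns :
    ∑ a, Complex.normSq (tetrahedron a 0) = 2 ∧ ∑ a, Complex.normSq (tetrahedron a 1) = 2 ∧
      ∑ a, tetrahedron a 0 * star (tetrahedron a 1) = 0 := by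
  have h2 : √2 ^ 2 = 2 := Real.sq_sqrt (by norm_num)
  have h3 : √3 ^ 2 = 3 := Real.sq_sqrt (by norm_num)
  refine ⟨?_, ?_, ?_⟩
  · simp [tetrahedron, Complex.normSq_apply, Fin.sum_univ_four]; ring_nf; norm_num [h3]
  · simp [tetrahedron, Complex.normSq_apply, Fin.sum_univ_four]; ring_nf; norm_num [h2, h3]
  · apply Complex.ext <;> simp [tetrahedron, Fin.sum_univ_four] <;> ring

theorem aSeq_four_mul_le {q : ℕ} (hq : 0 < q) :
    (4 * q : ℕ) * aSeq (4 * q) ≤ 2 - 2 / √3 := by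
  have hq0 : (0 : ℝ) < q := by exact_mod_cast hq
  have hs3 : √3 ^ 2 = 3 := Real.sq_sqrt (by norm_num)
  have hs1 : 1 < √3 := by rw [Real.lt_sqrt] <;> norm_num
  set x : ℝ := (√(2 * q))⁻¹ with hx
  have hx2 : x * x = (2 * q : ℝ)⁻¹ := by
    rw [hx, ← mul_inv, Real.mul_self_sqrt (by positivity)]
  set U : Matrix (Fin (4 * q)) (Fin 2) ℂ :=
    Matrix.of fun i k => (x : ℂ) * tetrahedron (finProdFinEquiv.symm i).1 k with hUdef
  have hUa : ∀ i k, U i k = (x : ℂ) * tetrahedron (finProdFinEquiv.symm i).1 k := fun _ _ => rfl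
  have hnorm : ∀ i k, Complex.normSq (U i k) =
      (2 * q : ℝ)⁻¹ * Complex.normSq (tetrahedron (finProdFinEquiv.symm i).1 k) := by
    intro i k
    rw [hUa, map_mul, Complex.normSq_ofReal, hx2]
  have hsum : ∀ {M : Type} [AddCommMonoid M] (f : Fin 4 → M),
      ∑ i : Fin (4 * q), f (finProdFinEquiv.symm i).1 = q • ∑ a, f a := by
    intro M _ f
    rw [Equiv.sum_comp finProdFinEquiv.symm (fun p : Fin 4 × Fin q => f p.1),
      Fintype.sum_prod_type]
    simp [Finset.smul_sum]
  obtain ⟨h0, h1, h2⟩ := tetrahedron_columns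
  have hU : Uᴴ * U = 1 := by
    rw [orthonormal_columns_iff]
    refine ⟨?_, ?_, ?_⟩
    · simp only [hnorm, ← Finset.mul_sum]
      rw [hsum fun a => Complex.normSq (tetrahedron a 0), h0, nsmul_eq_mul]
      field_simp
    · simp only [hnorm, ← Finset.mul_sum]
      rw [hsum fun a => Complex.normSq (tetrahedron a 1), h1, nsmul_eq_mul]
      field_simp
    · have : ∀ i, U i 0 * star (U i 1) = (x : ℂ) * x *
          (tetrahedron (finProdFinEquiv.symm i).1 0 *
            star (tetrahedron (finProdFinEquiv.symm i).1 1)) := by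
        intro i
        simp only [hUa, star_mul', Complex.star_def, Complex.conj_ofReal]
        ring
      simp only [this, ← Finset.mul_sum]
      rw [hsum fun a => tetrahedron a 0 * star (tetrahedron a 1), h2]
      simp
  have hy : (0 : ℝ) ≤ (2 * q : ℝ)⁻¹ * (1 - 1 / √3) := by
    have : 1 / √3 ≤ 1 := by rw [div_le_one (by linarith)]; exact hs1.le
    have : 0 ≤ 1 - 1 / √3 := by linarith
    positivity
  have hle : aSeq (4 * q) ≤ (2 * q : ℝ)⁻¹ * (1 - 1 / √3) := by
    refine (aSeq_le U hU).trans (Real.sSup_le ?_ hy)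
    rintro _ ⟨i, j, -, rfl⟩
    obtain ⟨M, e1, e2, e3⟩ := minEig_spec U i j
    have hdet : Complex.normSq (U i 0 * U j 1 - U i 1 * U j 0) ≤ (2 * q : ℝ)⁻¹ ^ 2 * (2 / 3) := by
      have : U i 0 * U j 1 - U i 1 * U j 0 = ((x * x : ℝ) : ℂ) *
          (tetrahedron (finProdFinEquiv.symm i).1 0 * tetrahedron (finProdFinEquiv.symm j).1 1 -
          tetrahedron (finProdFinEquiv.symm i).1 1 * tetrahedron (finProdFinEquiv.symm j).1 0) := by
        simp only [hUa]; push_cast; ring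
      rw [this, map_mul, Complex.normSq_ofReal, hx2, ← sq]
      exact mul_le_mul_of_nonneg_left (tetrahedron_det _ _) (by positivity)
    simp only [hnorm, ← mul_add, tetrahedron_row] at e2
    rw [← e3] at hdet
    set y : ℝ := (2 * q : ℝ)⁻¹
    have hy0 : 0 < y := by positivity
    have hinv : (1 / √3) ^ 2 = 1 / 3 := by rw [div_pow, hs3]; norm_num
    set z : ℝ := 1 / √3
    have hz0 : 0 < z := by positivity
    by_contra! hcon
    have hd : 0 ≤ y - minEig U i j := by linarith
    have hd' : y - minEig U i j < y * z := by linarith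
    have hM : M = 2 * y - minEig U i j := by linarith
    have h5 : (y - minEig U i j) ^ 2 < (y * z) ^ 2 := by gcongr
    rw [mul_pow, hinv] at h5
    rw [hM] at hdet
    nlinarith
  calc ((4 * q : ℕ) : ℝ) * aSeq (4 * q) ≤ (4 * q : ℕ) * ((2 * q : ℝ)⁻¹ * (1 - 1 / √3)) := by
        gcongr
    _ = 2 - 2 / √3 := by push_cast; field_simp; ring

theorem aSeq_antitoneOn : AntitoneOn aSeq (Set.Ici 2) := by
  intro m hm n _ hmn
  induction n, hmn using Nat.le_induction with
  | base => rfl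
  | succ k hk ih => exact (aSeq_succ_le (le_trans hm hk)).trans (ih (le_trans hm hk))

theorem sub_three_mul_aSeq_le {n : ℕ} (hn : 4 ≤ n) : ((n : ℝ) - 3) * aSeq n ≤ 2 - 2 / √3 := by
  have hle : 4 * (n / 4) ≤ n := Nat.mul_div_le n 4
  have h1 : aSeq n ≤ aSeq (4 * (n / 4)) :=
    aSeq_antitoneOn (Set.mem_Ici.2 (by omega)) (Set.mem_Ici.2 (by omega)) hle
  have h2 : (n : ℝ) ≤ (4 * (n / 4) : ℕ) + 3 := by exact_mod_cast (by omega)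
  have h3 : (4 : ℝ) ≤ n := by exact_mod_cast hn
  refine le_trans ?_ (aSeq_four_mul_le (q := n / 4) (by omega))
  have h4 : 0 ≤ aSeq (4 * (n / 4)) := by
    refine Real.sInf_nonneg ?_
    rintro _ ⟨U, -, rfl⟩
    exact sSup_minEig_nonneg U
  calc ((n : ℝ) - 3) * aSeq n ≤ ((n : ℝ) - 3) * aSeq (4 * (n / 4)) :=
        mul_le_mul_of_nonneg_left h1 (by linarith)
    _ ≤ _ := mul_le_mul_of_nonneg_right (by linarith) h4

theorem two_sub_two_div_sqrt_three_pos : 0 < 2 - 2 / √3 := by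
  have hs1 : 1 < √3 := by rw [Real.lt_sqrt] <;> norm_num
  have : 2 / √3 < 2 := by rw [div_lt_iff₀ (by linarith)]; linarith
  linarith

theorem aSeq_pos {n : ℕ} (hn : 2 ≤ n) : 0 < aSeq n := by
  have := two_sub_two_div_sqrt_three_pos.trans_le (le_mul_aSeq hn)
  exact pos_of_mul_pos_right this n.cast_nonneg

theorem tendsto_mul_aSeq :
    Filter.Tendsto (fun n : ℕ => (n : ℝ) * aSeq n) Filter.atTop (nhds (2 - 2 / √3)) := by
  have hlim : Filter.Tendsto (fun n : ℕ => (2 - 2 / √3) * ((n : ℝ) / ((n : ℝ) + (-3))))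
      Filter.atTop (nhds (2 - 2 / √3)) := by
    simpa using (tendsto_natCast_div_add_atTop (-3 : ℝ)).const_mul (2 - 2 / √3)
  refine tendsto_of_tendsto_of_tendsto_of_le_of_le' tendsto_const_nhds hlim ?_ ?_
  · filter_upwards [Filter.eventually_ge_atTop 2] with n hn using le_mul_aSeq hn
  · filter_upwards [Filter.eventually_ge_atTop 4] with n hn
    have h3 : (4 : ℝ) ≤ n := by exact_mod_cast hn
    have h := sub_three_mul_aSeq_le hn
    rw [← mul_div_assoc, le_div_iff₀ (by linarith)]
    nlinarith

/-- The sequence `(b n)_{n ≥ 3}` is nondecreasing and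
`√(n/α) / b n → 1` as `n → ∞`, where `α = 2 - 2/√3`; equivalently `n · a n → α`. -/
theorem bSeq_monotone_and_asymptotics :
    (∀ n : ℕ, 3 ≤ n → bSeq n ≤ bSeq (n + 1)) ∧
    Filter.Tendsto (fun n : ℕ => Real.sqrt (n / (2 - 2 / Real.sqrt 3)) / bSeq n)
      Filter.atTop (nhds 1) ∧
    Filter.Tendsto (fun n : ℕ => (n : ℝ) * aSeq n)
      Filter.atTop (nhds (2 - 2 / Real.sqrt 3)) := by
  refine ⟨fun n hn => ?_, ?_, tendsto_mul_aSeq⟩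
  · have h := aSeq_pos (n := n + 1) (by omega)
    exact one_div_le_one_div_of_le (Real.sqrt_pos.2 h)
      (Real.sqrt_le_sqrt (aSeq_succ_le (by omega)))
  · have hα := two_sub_two_div_sqrt_three_pos
    have h := (tendsto_mul_aSeq.div_const (2 - 2 / √3)).sqrt
    rw [div_self hα.ne', Real.sqrt_one] at h
    refine h.congr fun n => ?_
    rw [bSeq, div_div_eq_mul_div, div_one, ← Real.sqrt_mul (by positivity), div_mul_eq_mul_div]
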